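/- Assume g is odd, and let K̄ be an algebraic closure of K. Then for every θ ∈ K ∪ {∞} and every nonzero tuple (x, y, z, u, v) ∈ K̄⁵ satisfying x² − a z² = −b (u − A_θ v)(u − B_θ v) and x² − a y² = −a C_θ² u v, the 2×5 Jacobian matrix with rows (2x, 0, −2az, b(2u − (A_θ+B_θ)v), b(2A_θB_θv − (A_θ+B_θ)u)) and (2x, −2ay, 0, aC_θ²v, aC_θ²u) has rank 2; i.e., the fiber S_θ is a smooth complete intersection of two quadrics in ℙ⁴ (a del Pezzo surface of degree 4). -/

import Mathlib

open NumberField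

/-- `D_θ = a^{2h+1} b^{2h+1} θ^{g+1} − 1`. -/
def Dval {F : Type*} [Field F] (a b : F) (h g : ℕ) (θ : F) : F :=
  a ^ (2 * h + 1) * b ^ (2 * h + 1) * θ ^ (g + 1) - 1

/-- `C_θ = a^{2h+1} θ^{g+1} − 1`. -/
def Cval {F : Type*} [Field F] (a : F) (h g : ℕ) (θ : F) : F :=
  a ^ (2 * h + 1) * θ ^ (g + 1) - 1

/-- `A_θ = a^{4h+3} θ^{2g+2} + b c² d D_θ²`. -/
def Aval {F : Type*} [Field F] (a b c d : F) (h g : ℕ) (θ : F) : F :=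
  a ^ (4 * h + 3) * θ ^ (2 * g + 2) + b * c ^ 2 * d * (Dval a b h g θ) ^ 2

/-- `B_θ = a^{4h+3} θ^{2g+2} + (b c² d + 2c) D_θ²`. -/
def Bval {F : Type*} [Field F] (a b c d : F) (h g : ℕ) (θ : F) : F :=
  a ^ (4 * h + 3) * θ ^ (2 * g + 2) + (b * c ^ 2 * d + 2 * c) * (Dval a b h g θ) ^ 2

/-- `D_∞ = a^{2h+1} b^{2h+1}`. -/
def Dinf {F : Type*} [Field F] (a b : F) (h : ℕ) : F := a ^ (2 * h + 1) * b ^ (2 * h + 1)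

/-- `C_∞ = a^{2h+1}`. -/
def Cinf {F : Type*} [Field F] (a : F) (h : ℕ) : F := a ^ (2 * h + 1)

/-- `A_∞ = a^{4h+3} + b c² d D_∞²`. -/
def Ainf {F : Type*} [Field F] (a b c d : F) (h : ℕ) : F :=
  a ^ (4 * h + 3) + b * c ^ 2 * d * (Dinf a b h) ^ 2

/-- `B_∞ = a^{4h+3} + (b c² d + 2c) D_∞²`. -/
def Binf {F : Type*} [Field F] (a b c d : F) (h : ℕ) : F :=
  a ^ (4 * h + 3) + (b * c ^ 2 * d + 2 * c) * (Dinf a b h) ^ 2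

/-- `a, b, c, d ∈ 𝓞 K` generate pairwise distinct nonzero prime ideals,
none of which divides `(2)`. -/
def GoodParams (K : Type*) [Field K] [NumberField K] (a b c d : 𝓞 K) : Prop :=
  (Ideal.span {a} : Ideal (𝓞 K)).IsPrime ∧ (Ideal.span {b} : Ideal (𝓞 K)).IsPrime ∧
  (Ideal.span {c} : Ideal (𝓞 K)).IsPrime ∧ (Ideal.span {d} : Ideal (𝓞 K)).IsPrime ∧
  a ≠ 0 ∧ b ≠ 0 ∧ c ≠ 0 ∧ d ≠ 0 ∧
  (Ideal.span {a} : Ideal (𝓞 K)) ≠ Ideal.span {b} ∧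
  (Ideal.span {a} : Ideal (𝓞 K)) ≠ Ideal.span {c} ∧
  (Ideal.span {a} : Ideal (𝓞 K)) ≠ Ideal.span {d} ∧
  (Ideal.span {b} : Ideal (𝓞 K)) ≠ Ideal.span {c} ∧
  (Ideal.span {b} : Ideal (𝓞 K)) ≠ Ideal.span {d} ∧
  (Ideal.span {c} : Ideal (𝓞 K)) ≠ Ideal.span {d} ∧
  ¬ a ∣ 2 ∧ ¬ b ∣ 2 ∧ ¬ c ∣ 2 ∧ ¬ d ∣ 2

/-- The image of `x ∈ 𝓞 K` in the algebraic closure of `K`. -/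
noncomputable def par (K : Type*) [Field K] [NumberField K] (x : 𝓞 K) :
    AlgebraicClosure K :=
  algebraMap K (AlgebraicClosure K) (algebraMap (𝓞 K) K x)

/-- The Jacobian rank-2 condition for the del Pezzo surface with coefficients
`a, A, B, C` at a point `(x, y, z, u, v)`. -/
def JacobianRankTwo {F : Type*} [Field F] (a b A B C x y z u v : F) : Prop :=
  Matrix.rank
    (!![2 * x, 0, -(2 * a * z), b * (2 * u - (A + B) * v), b * (2 * A * B * v - (A + B) * u);
        2 * x, -(2 * a * y), 0, a * C ^ 2 * v, a * C ^ 2 * u] : Matrix (Fin 2) (Fin 5) F) = 2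

/-- The fiber with coefficients `a, b, A, B, C` is smooth as soon as the members of the pencil
of quadrics it spans degenerate at five distinct parameters. -/
theorem jacobianRankTwo_of_ne_zero {F : Type*} [Field F] [CharZero F] {a b A B C : F}
    (ha : a ≠ 0) (hb : b ≠ 0) (hC : C ≠ 0) (hA : A ≠ 0) (hB : B ≠ 0) (hAB : A - B ≠ 0)
    (hE : b ^ 2 * (A - B) ^ 2 + 2 * a * b * (A + B) * C ^ 2 + a ^ 2 * C ^ 4 ≠ 0)
    {x y z u v : F} (h0 : ¬ (x = 0 ∧ y = 0 ∧ z = 0 ∧ u = 0 ∧ v = 0))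
    (h1 : x ^ 2 - a * z ^ 2 = -(b * ((u - A * v) * (u - B * v))))
    (h2 : x ^ 2 - a * y ^ 2 = -(a * C ^ 2 * (u * v))) :
    JacobianRankTwo a b A B C x y z u v := by
  have key : LinearIndependent F (!![2 * x, 0, -(2 * a * z), b * (2 * u - (A + B) * v),
        b * (2 * A * B * v - (A + B) * u);
        2 * x, -(2 * a * y), 0, a * C ^ 2 * v, a * C ^ 2 * u] : Matrix (Fin 2) (Fin 5) F).row := by
    refine LinearIndependent.pair_iff.2 fun l m hlm => ?_
    have e0 := congrFun hlm 0
    have e1 := congrFun hlm 1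
    have e2 := congrFun hlm 2
    have e3 := congrFun hlm 3
    have e4 := congrFun hlm 4
    simp [ha] at e0 e1 e2 e3 e4
    by_contra hne
    apply h0
    by_cases hl : l = 0
    · have hm : m ≠ 0 := fun hm => hne ⟨hl, hm⟩
      simp [hl, hm, ha, hC] at e0 e1 e3 e4
      subst e0 e1 e3 e4
      simpa [ha] using h1
    by_cases hm : m = 0
    · simp [hl, hm, hb] at e0 e2 e3 e4
      have hv : (A - B) ^ 2 * v = 0 := by linear_combination -(A + B) * e3 - 2 * e4
      have hv : v = 0 := by simpa [hAB] using hv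
      have hu : u = 0 := by simpa [hv] using e3
      subst e0 e2 hv hu
      simpa [ha] using h2
    have hy : y = 0 := by simpa [hm] using e1
    have hz : z = 0 := by simpa [hl] using e2
    subst hy hz
    have hx : x = 0 := by
      by_contra hx
      have hml : m = -l := by
        have : x * (2 * (l + m)) = 0 := by linear_combination e0
        have : l + m = 0 := by simpa [hx] using this
        linear_combination this
      subst hml
      have f3 : b * (2 * u - (A + B) * v) - a * C ^ 2 * v = 0 := by
        apply (mul_eq_zero.1 (?_ : l * _ = 0)).resolve_left hl
        linear_combination e3
      have f4 : b * (2 * A * B * v - (A + B) * u) - a * C ^ 2 * u = 0 := by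
        apply (mul_eq_zero.1 (?_ : l * _ = 0)).resolve_left hl
        linear_combination e4
      have hv : v = 0 := by
        apply (mul_eq_zero.1 (?_ : (b ^ 2 * (A - B) ^ 2 + 2 * a * b * (A + B) * C ^ 2
          + a ^ 2 * C ^ 4) * v = 0)).resolve_left hE
        linear_combination -(b * (A + B) + a * C ^ 2) * f3 - 2 * b * f4
      apply hx
      simpa [hv] using h2
    subst hx
    have huv : u = 0 ∨ v = 0 := by simpa [ha, hC] using h2
    rcases huv with hu | hv
    · subst hu
      have : v = 0 := by simpa [hb, hA, hB] using h1
      simp [this]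
    · subst hv
      have : u = 0 := by simpa [hb] using h1
      simp [this]
  simpa [JacobianRankTwo] using key.rank_matrix

/-- Comparing parities of the multiplicity of a prime `p` on both sides. -/
theorem eq_zero_of_odd_pow_mul_sq_eq {R : Type*} [CommRing R] [IsDomain R] [WfDvdMonoid R]
    {p r r' x y : R} (hp : Prime p) (hr : ¬ p ∣ r) (hr' : ¬ p ∣ r') (k : ℕ)
    (hxy : p ^ (2 * k + 1) * r * x ^ 2 = r' * y ^ 2) : x = 0 := by
  by_contra hx
  have hr0 : r ≠ 0 := fun e => hr (e ▸ dvd_zero p)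
  have hy : y ≠ 0 := by
    rintro rfl
    simp [hp.ne_zero, hr0, hx] at hxy
  have fx := FiniteMultiplicity.of_prime_left hp hx
  have fy := FiniteMultiplicity.of_prime_left hp hy
  have e := congrArg (emultiplicity p) hxy
  rw [emultiplicity_mul hp, emultiplicity_mul hp, emultiplicity_mul hp, emultiplicity_pow hp,
    emultiplicity_pow hp, emultiplicity_pow hp, emultiplicity_eq_zero.2 hr,
    emultiplicity_eq_zero.2 hr', fx.emultiplicity_eq_multiplicity,
    fy.emultiplicity_eq_multiplicity, (FiniteMultiplicity.of_prime_left hp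
      hp.ne_zero).emultiplicity_eq_multiplicity, multiplicity_self] at e
  norm_cast at e
  omega

/-- Every fraction has a representative whose numerator and denominator are not both divisible
by a given prime. -/
theorem exists_mul_eq_mul_not_dvd {R : Type*} [CommRing R] [IsDomain R] [WfDvdMonoid R]
    {p : R} (hp : Prime p) (t : R) (ht : t ≠ 0) :
    ∀ s : R, ∃ s' t' : R, t' ≠ 0 ∧ s * t' = s' * t ∧ ¬ (p ∣ s' ∧ p ∣ t') := by
  induction t using (wellFounded_dvdNotUnit (α := R)).induction with
  | _ t ih =>
    intro s
    by_cases hst : p ∣ s ∧ p ∣ t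
    · obtain ⟨⟨s₁, rfl⟩, ⟨t₁, rfl⟩⟩ := hst
      have ht₁ : t₁ ≠ 0 := right_ne_zero_of_mul ht
      obtain ⟨s', t', h1, h2, h3⟩ := ih t₁ ⟨ht₁, p, hp.not_isUnit, mul_comm _ _⟩ ht₁ s₁
      exact ⟨s', t', h1, by linear_combination p * h2, h3⟩
    · exact ⟨s, t, ht, rfl, hst⟩

/-- The quantities whose nonvanishing makes the fiber over `(s : t)` smooth, in homogeneous
coordinates with `N` the even exponent. -/
theorem homogeneous_ne_zero {R : Type*} [CommRing R] [IsDomain R] [WfDvdMonoid R]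
    {a b c d : R} (ha : Prime a) (hb : Prime b) (hc : Prime c)
    (hab : ¬ a ∣ b) (hac : ¬ a ∣ c) (had : ¬ a ∣ d) (hba : ¬ b ∣ a) (hbc : ¬ b ∣ c)
    (hca : ¬ c ∣ a) (hb2 : ¬ b ∣ 2) (hc2 : ¬ c ∣ 2)
    (h n : ℕ) (hn : n ≠ 0) {s t C D A B : R} (hst : ¬ (b ∣ s ∧ b ∣ t))
    (hC : C = a ^ (2 * h + 1) * s ^ (2 * n) - t ^ (2 * n))
    (hD : D = a ^ (2 * h + 1) * b ^ (2 * h + 1) * s ^ (2 * n) - t ^ (2 * n))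
    (hA : A = a ^ (4 * h + 3) * s ^ (4 * n) + b * c ^ 2 * d * D ^ 2)
    (hB : B = a ^ (4 * h + 3) * s ^ (4 * n) + (b * c ^ 2 * d + 2 * c) * D ^ 2) :
    C ≠ 0 ∧ D ≠ 0 ∧ A ≠ 0 ∧ B ≠ 0 ∧
      b ^ 2 * (A - B) ^ 2 + 2 * a * b * (A + B) * C ^ 2 + a ^ 2 * C ^ 4 ≠ 0 := by
  have ha1 : ¬ a ∣ 1 := fun e => ha.not_isUnit (isUnit_of_dvd_one e)
  have hn2 : 2 * n ≠ 0 := by omega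
  have hs_of (e : s = 0) (e' : t ^ (2 * n) = 0) : False :=
    hst ⟨e ▸ dvd_zero _, (pow_eq_zero_iff hn2).1 e' ▸ dvd_zero _⟩
  have hC0 : C ≠ 0 := by
    intro e
    have hs : s = 0 := by
      refine (pow_eq_zero_iff hn).1 (eq_zero_of_odd_pow_mul_sq_eq ha ha1 ha1 h
        (y := t ^ n) ?_)
      linear_combination e - hC
    refine hs_of hs ?_
    rw [e, hs, zero_pow hn2] at hC
    linear_combination hC
  have hD0 : D ≠ 0 := by
    intro e
    have hs : s = 0 := by
      refine (pow_eq_zero_iff hn).1 (eq_zero_of_odd_pow_mul_sq_eq ha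
        (r := b ^ (2 * h + 1)) (fun e => hab (ha.dvd_of_dvd_pow e)) ha1 h (y := t ^ n) ?_)
      linear_combination e - hD
    refine hs_of hs ?_
    rw [e, hs, zero_pow hn2] at hD
    linear_combination hD
  have hbcd : ¬ a ∣ -(b * c ^ 2 * d) := by
    rw [dvd_neg, ha.dvd_mul, ha.dvd_mul, ha.dvd_pow_iff_dvd two_ne_zero]
    tauto
  have hA0 : A ≠ 0 := by
    intro e
    have hS : s ^ (2 * n) = 0 := eq_zero_of_odd_pow_mul_sq_eq ha ha1 hbcd (2 * h + 1) (y := D) (by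
      linear_combination e - hA)
    have hD' : -(b * c ^ 2 * d) * D ^ 2 = 0 := by
      linear_combination hA - e + a ^ (4 * h + 3) * s ^ (2 * n) * hS
    have : -(b * c ^ 2 * d) ≠ 0 := fun e => hbcd (e ▸ dvd_zero _)
    exact (mul_ne_zero this (pow_ne_zero 2 hD0)) hD'
  have hB0 : B ≠ 0 := by
    intro e
    refine hD0 (eq_zero_of_odd_pow_mul_sq_eq hc (r := b * c * d + 2)
      (r' := -a ^ (4 * h + 3)) (y := s ^ (2 * n)) ?_ ?_ 0 ?_)
    · rw [dvd_add_right (Dvd.intro_left b rfl |>.mul_right d)]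
      exact hc2
    · rw [dvd_neg]
      exact fun e => hca (hc.dvd_of_dvd_pow e)
    · linear_combination e - hB
  refine ⟨hC0, hD0, hA0, hB0, fun e => ?_⟩
  have hbC : b ∣ C := by
    have : b ∣ a ^ 2 * C ^ 4 := by
      refine ⟨-(b * (A - B) ^ 2 + 2 * a * (A + B) * C ^ 2), ?_⟩
      linear_combination e
    exact hb.dvd_of_dvd_pow ((hb.dvd_mul.1 this).resolve_left fun e => hba (hb.dvd_of_dvd_pow e))
  obtain ⟨f, hf⟩ := hbC
  have hbD : b ∣ D := by
    have e' : b ^ 2 * ((2 * c * D ^ 2) ^ 2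
        + b * (2 * a * (A + B) * f ^ 2 + a ^ 2 * b * f ^ 4)) = 0 := by
      have hsub : A - B = -(2 * c * D ^ 2) := by linear_combination hA - hB
      rw [hsub, hf] at e
      linear_combination e
    have e' := (mul_eq_zero.1 e').resolve_left (pow_ne_zero 2 hb.ne_zero)
    have : b ∣ (2 * c * D ^ 2) ^ 2 := by
      refine ⟨-(2 * a * (A + B) * f ^ 2 + a ^ 2 * b * f ^ 4), ?_⟩
      linear_combination e'
    have := hb.dvd_of_dvd_pow this
    rw [hb.dvd_mul, hb.dvd_mul, hb.dvd_pow_iff_dvd two_ne_zero] at this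
    tauto
  obtain ⟨k, hk⟩ := hbD
  have ht : b ∣ t := by
    refine hb.dvd_of_dvd_pow (n := 2 * n) ⟨a ^ (2 * h + 1) * b ^ (2 * h) * s ^ (2 * n) - k, ?_⟩
    linear_combination hD - hk
  refine hst ⟨?_, ht⟩
  have : b ∣ a ^ (2 * h + 1) * s ^ (2 * n) := by
    have e1 : a ^ (2 * h + 1) * s ^ (2 * n) = b * f + t ^ (2 * n) := by
      linear_combination hf - hC
    rw [e1]
    exact dvd_add (dvd_mul_right _ _) (dvd_pow ht hn2)
  exact hb.dvd_of_dvd_pow ((hb.dvd_mul.1 this).resolve_left fun e => hba (hb.dvd_of_dvd_pow e))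

/-- A prime element does not divide a prime element generating a different ideal. -/
theorem not_dvd_of_span_ne {R : Type*} [CommRing R] [IsDomain R] {p q : R} (hp : Prime p)
    (hq : Prime q) (hpq : (Ideal.span {p} : Ideal R) ≠ Ideal.span {q}) : ¬ p ∣ q := fun hd =>
  hpq (Ideal.span_singleton_eq_span_singleton.2 (hp.associated_of_dvd hq hd))

/-- Proposition 4.3: if `g` is odd then for every `θ ∈ K ∪ {∞}` the fiber `S_θ` is a
smooth complete intersection of two quadrics in ℙ⁴ over an algebraic closure of `K`. -/
theorem stmt7 (K : Type*) [Field K] [NumberField K] (h g : ℕ) (hg1 : 1 ≤ g) (hgodd : Odd g)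
    (a b c d : 𝓞 K) (hP : GoodParams K a b c d) :
    (∀ θ : K, ∀ x y z u v : AlgebraicClosure K,
      ¬ (x = 0 ∧ y = 0 ∧ z = 0 ∧ u = 0 ∧ v = 0) →
      x ^ 2 - par K a * z ^ 2 =
        -(par K b *
          ((u - Aval (par K a) (par K b) (par K c) (par K d) h g
              (algebraMap K (AlgebraicClosure K) θ) * v) *
           (u - Bval (par K a) (par K b) (par K c) (par K d) h g
              (algebraMap K (AlgebraicClosure K) θ) * v))) →
      x ^ 2 - par K a * y ^ 2 =
        -(par K a * (Cval (par K a) h g (algebraMap K (AlgebraicClosure K) θ)) ^ 2 * (u * v)) →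
      JacobianRankTwo (par K a) (par K b)
        (Aval (par K a) (par K b) (par K c) (par K d) h g (algebraMap K (AlgebraicClosure K) θ))
        (Bval (par K a) (par K b) (par K c) (par K d) h g (algebraMap K (AlgebraicClosure K) θ))
        (Cval (par K a) h g (algebraMap K (AlgebraicClosure K) θ)) x y z u v) ∧
    (∀ x y z u v : AlgebraicClosure K,
      ¬ (x = 0 ∧ y = 0 ∧ z = 0 ∧ u = 0 ∧ v = 0) →
      x ^ 2 - par K a * z ^ 2 =
        -(par K b *
          ((u - Ainf (par K a) (par K b) (par K c) (par K d) h * v) *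
           (u - Binf (par K a) (par K b) (par K c) (par K d) h * v))) →
      x ^ 2 - par K a * y ^ 2 =
        -(par K a * (Cinf (par K a) h) ^ 2 * (u * v)) →
      JacobianRankTwo (par K a) (par K b)
        (Ainf (par K a) (par K b) (par K c) (par K d) h)
        (Binf (par K a) (par K b) (par K c) (par K d) h)
        (Cinf (par K a) h) x y z u v) := by
  obtain ⟨ha, hb, hc, hd, ha0, hb0, hc0, hd0, hab, hac, had, hbc, -, -, -, hb2, hc2, -⟩ := hP
  rw [Ideal.span_singleton_prime ‹_›] at ha hb hc hd
  obtain ⟨n, hn⟩ : ∃ n, g + 1 = 2 * n := hgodd.add_one.exists_two_nsmul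
  have hn' : 2 * g + 2 = 4 * n := by omega
  have hinj : Function.Injective (par K) :=
    (algebraMap K (AlgebraicClosure K)).injective.comp RingOfIntegers.coe_injective
  have par0 : par K 0 = 0 := by simp [par]
  have hne {r : 𝓞 K} (hr : r ≠ 0) : par K r ≠ 0 := fun e => hr (hinj (e.trans par0.symm))
  have key {s t : 𝓞 K} (hst : ¬ (b ∣ s ∧ b ∣ t)) :=
    homogeneous_ne_zero ha hb hc (not_dvd_of_span_ne ha hb hab) (not_dvd_of_span_ne ha hc hac)
      (not_dvd_of_span_ne ha hd had) (not_dvd_of_span_ne hb ha hab.symm)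
      (not_dvd_of_span_ne hb hc hbc) (not_dvd_of_span_ne hc ha hac.symm) hb2 hc2 h n (by omega)
      hst rfl rfl rfl rfl
  refine ⟨fun θ x y z u v h0 h1 h2 => ?_, fun x y z u v h0 h1 h2 => ?_⟩
  · obtain ⟨s₀, t₀, ht₀, hθ₀⟩ := IsFractionRing.div_surjective (A := 𝓞 K) θ
    obtain ⟨s, t, ht, hst₀, hst⟩ :=
      exists_mul_eq_mul_not_dvd hb t₀ (nonZeroDivisors.ne_zero ht₀) s₀
    have hτ : par K s = algebraMap K (AlgebraicClosure K) θ * par K t := by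
      have e₀ : algebraMap (𝓞 K) K t₀ ≠ 0 := by simpa using nonZeroDivisors.ne_zero ht₀
      have e := congrArg (algebraMap (𝓞 K) K) hst₀
      rw [map_mul, map_mul] at e
      rw [par, par, ← map_mul, ← hθ₀]
      congr 1
      field_simp
      exact e.symm
    generalize algebraMap K (AlgebraicClosure K) θ = τ at *
    obtain ⟨kC, kD, kA, kB, kE⟩ := key hst
    have iC := hne kC
    have iD := hne kD
    have iA := hne kA
    have iB := hne kB
    have iE := hne kE
    simp only [par, map_add, map_sub, map_mul, map_pow, map_ofNat] at iC iD iA iB iE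
    simp only [← par.eq_1, hτ] at iC iD iA iB iE
    refine jacobianRankTwo_of_ne_zero (hne ha0) (hne hb0) (fun e => iC ?_) (fun e => iA ?_)
      (fun e => iB ?_) (fun e => mul_ne_zero (mul_ne_zero two_ne_zero (hne hc0))
        (pow_ne_zero 2 iD) ?_) (fun e => iE ?_) h0 h1 h2 <;>
    simp only [Aval, Bval, Cval, Dval, hn, hn'] at e
    · linear_combination par K t ^ (2 * n) * e
    · linear_combination par K t ^ (4 * n) * e
    · linear_combination par K t ^ (4 * n) * e
    · linear_combination -par K t ^ (4 * n) * e
    · linear_combination par K t ^ (8 * n) * e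
  · obtain ⟨kC, kD, kA, kB, kE⟩ :=
      key (s := 1) (t := 0) fun e => hb.not_isUnit (isUnit_of_dvd_one e.1)
    have hn0 : 2 * n ≠ 0 := by omega
    have iC := hne kC
    have iD := hne kD
    have iA := hne kA
    have iB := hne kB
    have iE := hne kE
    simp only [par, map_add, map_sub, map_mul, map_pow, map_ofNat, one_pow,
      zero_pow hn0, mul_one, sub_zero] at iC iD iA iB iE
    simp only [← par.eq_1] at iC iD iA iB iE
    refine jacobianRankTwo_of_ne_zero (hne ha0) (hne hb0) iC iA iB ?_ iE h0 h1 h2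
    refine fun e => mul_ne_zero (mul_ne_zero two_ne_zero (hne hc0)) (pow_ne_zero 2 iD) ?_
    linear_combination -e
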